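/- arXiv:1207.1691 — 2 statements merged into one kernel-verified Lean document; each statement's English description precedes it below -/
import Mathlib

section
/- (Positivstellensatz for linear polynomials on spectrahedra) Let A be a linear pencil of symmetric α×α matrices in n variables and f a linear polynomial. Then f ≥ 0 on S_A if and only if there exist linear polynomials ℓ_1, ..., ℓ_n, quadratic sos-matrices S_1, ..., S_n ∈ Sℝ[x]^{α×α}, a positive semidefinite matrix S ∈ Sℝ^{α×α}, and c ≥ 0 such that ℓ_i² + tr(A S_i) ∈ (ℓ_1, ..., ℓ_{i-1}) for i = 1, ..., n, and f - c - tr(A S) ∈ (ℓ_1, ..., ℓ_n), where (ℓ_1,...,ℓ_k) denotes the ideal generated by ℓ_1,...,ℓ_k in ℝ[x]. -/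
open MvPolynomial Matrix
attribute [local instance] Matrix.frobeniusNormedAddCommGroup

noncomputable section

abbrev RP (n : ℕ) := MvPolynomial (Fin n) ℝ

/-- Evaluation of the linear pencil `A₀ + ∑ xᵢ Aᵢ` at a point `x ∈ ℝⁿ`. -/
def pencilEval {n α : ℕ} (A0 : Matrix (Fin α) (Fin α) ℝ) (A : Fin n → Matrix (Fin α) (Fin α) ℝ)
    (x : Fin n → ℝ) : Matrix (Fin α) (Fin α) ℝ :=
  A0 + ∑ i, x i • A i

/-- The linear pencil `A₀ + ∑ xᵢ Aᵢ` as a matrix of polynomials. -/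
def pencilPoly {n α : ℕ} (A0 : Matrix (Fin α) (Fin α) ℝ) (A : Fin n → Matrix (Fin α) (Fin α) ℝ) :
    Matrix (Fin α) (Fin α) (RP n) :=
  A0.map C + ∑ i, (X i : RP n) • (A i).map C

/-- `v^* M v` for a matrix of polynomials. -/
def quadForm {n α : ℕ} (M : Matrix (Fin α) (Fin α) (RP n)) (v : Fin α → RP n) : RP n :=
  v ⬝ᵥ (M *ᵥ v)

/-- A sum of squares of polynomials. -/
def IsSos {n : ℕ} (p : RP n) : Prop := ∃ (k : ℕ) (q : Fin k → RP n), p = ∑ i, q i ^ 2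

/-- An sos-matrix: a finite sum `∑ vⱼ vⱼ^*` with `vⱼ` vectors of polynomials. -/
def IsSosMatrix {n α : ℕ} (S : Matrix (Fin α) (Fin α) (RP n)) : Prop :=
  ∃ (k : ℕ) (v : Fin k → Fin α → RP n), S = ∑ j, Matrix.vecMulVec (v j) (v j)

/-- Membership in the quadratic module `M_A` associated to the pencil. -/
def InQuadModule {n α : ℕ} (A0 : Matrix (Fin α) (Fin α) ℝ)
    (A : Fin n → Matrix (Fin α) (Fin α) ℝ) (p : RP n) : Prop :=
  ∃ s, IsSos s ∧ ∃ (k : ℕ) (v : Fin k → Fin α → RP n),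
    p = s + ∑ j, quadForm (pencilPoly A0 A) (v j)

/-- Strong infeasibility: positive distance (Frobenius norm) between the range of the
pencil and the PSD cone. -/
def StronglyInfeasible {n α : ℕ} (A0 : Matrix (Fin α) (Fin α) ℝ)
    (A : Fin n → Matrix (Fin α) (Fin α) ℝ) : Prop :=
  ∃ ε > (0:ℝ), ∀ (x : Fin n → ℝ) (B : Matrix (Fin α) (Fin α) ℝ), B.PosSemidef →
    ε ≤ dist (pencilEval A0 A x) B

lemma sep_isOpen (α : ℕ) : IsOpen {p : (Fin α → Fin α → ℝ) × ℝ | p.2 < 0 ∧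
    ∀ v : Fin α → ℝ, v ≠ 0 → 0 < ∑ i, ∑ j, v i * p.1 i j * v j} := by
  have : {p : (Fin α → Fin α → ℝ) × ℝ | p.2 < 0 ∧
    ∀ v : Fin α → ℝ, v ≠ 0 → 0 < ∑ i, ∑ j, v i * p.1 i j * v j} =
    {p | p.2 < 0} ∩ {p : (Fin α → Fin α → ℝ) × ℝ |
      ∀ v ∈ Metric.sphere (0 : Fin α → ℝ) 1, 0 < ∑ i, ∑ j, v i * p.1 i j * v j} := by
    ext p
    simp only [Set.mem_ofPred_eq, Set.mem_inter_iff]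
    refine and_congr_right fun _ => ⟨fun h v hv => h v ?_, fun h v hv => ?_⟩
    · rintro rfl
      simp at hv
    · have hn : 0 < ‖v‖ := norm_pos_iff.mpr hv
      have := h (‖v‖⁻¹ • v) (by simp [norm_smul, hn.ne'])
      have e : ∑ i, ∑ j, v i * p.1 i j * v j =
          ‖v‖ ^ 2 * ∑ i, ∑ j, (‖v‖⁻¹ • v) i * p.1 i j * (‖v‖⁻¹ • v) j := by
        simp only [Finset.mul_sum]
        refine Finset.sum_congr rfl fun i _ => Finset.sum_congr rfl fun j _ => ?_
        simp only [Pi.smul_apply, smul_eq_mul]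
        field_simp
      rw [e]
      positivity
  rw [this]
  refine (isOpen_lt (by fun_prop) (by fun_prop)).inter ?_
  rw [isOpen_iff_mem_nhds]
  intro p hp
  refine (isCompact_sphere (0 : Fin α → ℝ) 1).eventually_forall_of_forall_eventually ?_
  intro v hv
  have hc : Continuous fun z : ((Fin α → Fin α → ℝ) × ℝ) × (Fin α → ℝ) =>
      ∑ i, ∑ j, z.2 i * z.1.1 i j * z.2 j := by fun_prop
  exact (hc.tendsto (p, v)).eventually (lt_mem_nhds (hp v hv))

lemma clm_repr {α : ℕ} (g : ((Fin α → Fin α → ℝ) × ℝ) →L[ℝ] ℝ) :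
    ∃ (B : Fin α → Fin α → ℝ) (b : ℝ), ∀ M t, g (M, t) = b * t - ∑ i, ∑ j, B i j * M i j := by
  refine ⟨fun i j => - g (Pi.single i (Pi.single j 1), 0), g (0, 1), fun M t => ?_⟩
  have h1 : ((M, t) : (Fin α → Fin α → ℝ) × ℝ) = t • ((0 : Fin α → Fin α → ℝ), (1:ℝ)) +
      ∑ i, ∑ j, M i j • ((Pi.single i (Pi.single j 1) : Fin α → Fin α → ℝ), (0:ℝ)) := by
    ext a b
    · simp [Prod.fst_sum, Finset.sum_apply, Pi.single_apply, apply_ite]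
    · simp [Prod.snd_sum]
  rw [h1]
  simp only [map_add, map_sum, map_smul, smul_eq_mul]
  simp [Finset.sum_neg_distrib, mul_comm]

/-- scaling trick -/
lemma aux_eps {a b : ℝ} (h : ∀ ε > (0:ℝ), a + ε * b ≤ 0) : a ≤ 0 := by
  by_contra! ha
  have := h (a / (2 * (|b| + 1))) (by positivity)
  have h2 : a / (2 * (|b| + 1)) * b ≥ - (a / 2) := by
    have h3 : a / (2 * (|b| + 1)) * b ≥ - (a / (2 * (|b| + 1)) * (|b| + 1)) := by
      have : 0 < a / (2 * (|b| + 1)) := by positivity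
      nlinarith [neg_abs_le b]
    have h4 : a / (2 * (|b| + 1)) * (|b| + 1) = a / 2 := by
      have : |b| + 1 ≠ 0 := by positivity
      field_simp
    linarith
  linarith

lemma aux_lam {a u : ℝ} (h : ∀ l > (0:ℝ), l * a < u) : a ≤ 0 ∧ 0 ≤ u := by
  constructor
  · by_contra! ha
    have := h ((|u| + 1) / a) (by positivity)
    rw [div_mul_cancel₀ _ ha.ne'] at this
    linarith [le_abs_self u]
  · have : -u ≤ 0 := aux_eps (b := a) fun ε hε => by linarith [h ε hε]
    linarith

lemma aux_affine {n : ℕ} {a : ℝ} {c : Fin n → ℝ} (h : ∀ x : Fin n → ℝ, 0 ≤ a + ∑ i, x i * c i) :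
    0 ≤ a ∧ ∀ i, c i = 0 := by
  have h0 : 0 ≤ a := by simpa using h 0
  refine ⟨h0, fun i => ?_⟩
  by_contra hc
  have := h (Pi.single i (-(a + 1) / c i))
  simp [Pi.single_apply] at this
  rw [div_mul_cancel₀ _ hc] at this
  linarith

lemma sep0 {n α : ℕ} (K0 : Matrix (Fin α) (Fin α) ℝ) (K : Fin n → Matrix (Fin α) (Fin α) ℝ)
    (hK0 : K0.IsSymm) (hK : ∀ i, (K i).IsSymm) (f0 : ℝ) (fc : Fin n → ℝ)
    (hd : ∀ x : Fin n → ℝ, (pencilEval K0 K x).PosSemidef → 0 ≤ f0 + ∑ i, x i * fc i) :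
    ∃ (B : Matrix (Fin α) (Fin α) ℝ) (b c : ℝ), B.PosSemidef ∧ 0 ≤ b ∧ 0 ≤ c ∧ (b = 0 → B ≠ 0) ∧
      b * f0 = c + (K0 * B).trace ∧ ∀ i, b * fc i = (K i * B).trace := by
  have hsymx : ∀ x, (pencilEval K0 K x).IsSymm := by
    intro x
    unfold pencilEval Matrix.IsSymm
    rw [Matrix.transpose_add, Matrix.transpose_sum, hK0.eq]
    simp [fun i => (hK i).eq]
  have hconv : Convex ℝ {p : (Fin α → Fin α → ℝ) × ℝ | p.2 < 0 ∧
      ∀ v : Fin α → ℝ, v ≠ 0 → 0 < ∑ i, ∑ j, v i * p.1 i j * v j} := by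
    rw [convex_iff_forall_pos]
    rintro p ⟨hp1, hp2⟩ q ⟨hq1, hq2⟩ a b ha hb hab
    refine ⟨?_, fun v hv => ?_⟩
    · simp only [Prod.snd_add, Prod.smul_snd, smul_eq_mul]
      nlinarith
    · have e : ∑ i, ∑ j, v i * (a • p + b • q).1 i j * v j =
        a * (∑ i, ∑ j, v i * p.1 i j * v j) + b * ∑ i, ∑ j, v i * q.1 i j * v j := by
        simp only [Finset.mul_sum, ← Finset.sum_add_distrib]
        refine Finset.sum_congr rfl fun i _ => Finset.sum_congr rfl fun j _ => ?_
        simp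
        ring
      rw [e]
      have := hp2 v hv
      have := hq2 v hv
      positivity
  have hconvT : Convex ℝ (Set.range fun x : Fin n → ℝ =>
      (((fun i j => pencilEval K0 K x i j), f0 + ∑ i, x i * fc i) :
        (Fin α → Fin α → ℝ) × ℝ)) := by
    rintro _ ⟨x, rfl⟩ _ ⟨y, rfl⟩ a b ha hb hab
    refine ⟨a • x + b • y, ?_⟩
    have hb' : b = 1 - a := by linarith
    subst hb'
    ext i j
    · simp [pencilEval, Matrix.sum_apply, add_mul, Finset.sum_add_distrib, mul_assoc, ← Finset.mul_sum]
      ring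
    · simp [add_mul, Finset.sum_add_distrib, mul_assoc, ← Finset.mul_sum]
      ring
  obtain ⟨g, u, hg1, hg2⟩ := geometric_hahn_banach_open hconv (sep_isOpen α) hconvT (by
    rw [Set.disjoint_left]
    rintro _ ⟨h1, h2⟩ ⟨x, rfl⟩
    simp only at h1 h2
    refine absurd (hd x ?_) (not_le.mpr h1)
    refine .of_dotProduct_mulVec_nonneg ?_ fun v => ?_
    · have := hsymx x
      rw [Matrix.IsHermitian, Matrix.conjTranspose_eq_transpose_of_trivial]
      exact this
    · by_cases hv : v = 0
      · simp [hv]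
      · have := (h2 v hv).le
        simpa [dotProduct, mulVec, Finset.mul_sum, mul_assoc] using this)
  obtain ⟨B0, b, hg⟩ := clm_repr g
  -- consequences on the cone
  have hcone : ∀ (M : Fin α → Fin α → ℝ) (t : ℝ), t < 0 →
      (∀ v : Fin α → ℝ, v ≠ 0 → 0 < ∑ i, ∑ j, v i * M i j * v j) →
      b * t - ∑ i, ∑ j, B0 i j * M i j ≤ 0 ∧ 0 ≤ u := by
    intro M t ht hM
    apply aux_lam
    intro l hl
    have := hg1 (l • M, l * t) ⟨by simp only; nlinarith, fun v hv => ?_⟩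
    · rw [hg] at this
      refine lt_of_eq_of_lt ?_ this
      simp only [Pi.smul_apply, smul_eq_mul, mul_sub, Finset.mul_sum]
      congr 1
      · ring
      · refine Finset.sum_congr rfl fun i _ => Finset.sum_congr rfl fun j _ => by ring
    · have e : ∑ i, ∑ j, v i * (l • M) i j * v j = l * ∑ i, ∑ j, v i * M i j * v j := by
        simp only [Finset.mul_sum]
        refine Finset.sum_congr rfl fun i _ => Finset.sum_congr rfl fun j _ => ?_
        simp
        ring
      simp only
      rw [e]
      have := hM v hv
      positivity
  have hIsum : ∀ v : Fin α → ℝ, v ≠ 0 → 0 < ∑ i, v i * v i := by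
    intro v hv
    obtain ⟨i, hi⟩ := Function.ne_iff.mp hv
    refine Finset.sum_pos' (fun i _ => mul_self_nonneg _) ⟨i, Finset.mem_univ _, ?_⟩
    exact mul_self_pos.mpr hi
  have hqI : ∀ (ε : ℝ) (v : Fin α → ℝ), ∑ i, ∑ j, v i * (if i = j then ε else 0) * v j
      = ε * ∑ i, v i * v i := by
    intro ε v
    simp [Finset.mul_sum]
    refine Finset.sum_congr rfl fun i _ => by ring
  have hBI : ∀ (ε : ℝ), ∑ i, ∑ j, B0 i j * (if i = j then ε else 0) = ε * ∑ i, B0 i i := by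
    intro ε
    simp [Finset.mul_sum]
    refine Finset.sum_congr rfl fun i _ => by ring
  have hu : 0 ≤ u := (hcone (fun i j => if i = j then 1 else 0) (-1) (by norm_num) (by
    intro v hv
    rw [hqI]; simpa using hIsum v hv)).2
  have hb : 0 ≤ b := by
    have : -b ≤ 0 := aux_eps (b := - ∑ i, B0 i i) fun ε hε => by
      have := (hcone (fun i j => if i = j then ε else 0) (-1) (by norm_num) (by
        intro v hv
        rw [hqI]; have := hIsum v hv; positivity)).1
      rw [hBI] at this
      linarith
    linarith
  have hB0 : ∀ v : Fin α → ℝ, 0 ≤ ∑ i, ∑ j, v i * B0 i j * v j := by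
    intro v
    have : - ∑ i, ∑ j, v i * B0 i j * v j ≤ 0 :=
      aux_eps (b := - ∑ i, B0 i i - b) fun ε hε => by
      have := (hcone (fun i j => v i * v j + if i = j then ε else 0) (-ε) (by linarith) (by
        intro w hw
        have h1 := hIsum w hw
        have e : ∑ i, ∑ j, w i * (v i * v j) * w j = (∑ i, w i * v i) * ∑ i, w i * v i := by
          rw [Finset.sum_mul_sum]
          refine Finset.sum_congr rfl fun i _ => Finset.sum_congr rfl fun j _ => by ring
        simp only [mul_add, add_mul, Finset.sum_add_distrib]
        rw [hqI, e]
        have := mul_self_nonneg (∑ i, w i * v i)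
        positivity)).1
      simp only [mul_add, Finset.sum_add_distrib] at this
      rw [hBI] at this
      have e : ∑ i, ∑ j, B0 i j * (v i * v j) = ∑ i, ∑ j, v i * B0 i j * v j := by
        refine Finset.sum_congr rfl fun i _ => Finset.sum_congr rfl fun j _ => by ring
      rw [e] at this
      linarith
    linarith
  let B : Matrix (Fin α) (Fin α) ℝ := Matrix.of fun i j => (B0 i j + B0 j i) / 2
  have htr : ∀ M : Matrix (Fin α) (Fin α) ℝ, M.IsSymm →
      (M * B).trace = ∑ i, ∑ j, B0 i j * M i j := by
    intro M hM
    have e1 : (M * B).trace = ∑ i, ∑ j, (B0 i j * M i j / 2 + B0 j i * M j i / 2) := by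
      simp only [Matrix.trace, Matrix.diag_apply, Matrix.mul_apply]
      refine Finset.sum_congr rfl fun i _ => Finset.sum_congr rfl fun j _ => ?_
      have := hM.apply i j
      simp only [B, Matrix.of_apply]
      rw [this]
      ring
    have e2 : ∑ i, ∑ j, B0 j i * M j i / 2 = ∑ i, ∑ j, B0 i j * M i j / 2 := Finset.sum_comm
    rw [e1]
    simp only [Finset.sum_add_distrib]
    rw [e2, ← Finset.sum_add_distrib]
    refine Finset.sum_congr rfl fun i _ => ?_
    rw [← Finset.sum_add_distrib]
    refine Finset.sum_congr rfl fun j _ => by ring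
  have hBpsd : B.PosSemidef := by
    refine .of_dotProduct_mulVec_nonneg ?_ fun v => ?_
    · ext i j
      simp [B, add_comm]
    · have := hB0 v
      have e2 : ∑ i, ∑ j, v i * B0 j i * v j = ∑ i, ∑ j, v i * B0 i j * v j := by
        rw [Finset.sum_comm]
        refine Finset.sum_congr rfl fun i _ => Finset.sum_congr rfl fun j _ => by ring
      have e : star v ⬝ᵥ B *ᵥ v =
          ((∑ i, ∑ j, v i * B0 i j * v j) + ∑ i, ∑ j, v i * B0 j i * v j) / 2 := by
        simp only [dotProduct, mulVec, Finset.mul_sum, ← Finset.sum_add_distrib, Finset.sum_div]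
        refine Finset.sum_congr rfl fun i _ => Finset.sum_congr rfl fun j _ => ?_
        simp [B]
        ring
      rw [e, e2]
      linarith
  have hT : ∀ x : Fin n → ℝ, u ≤ (b * f0 - (K0 * B).trace) +
      ∑ i, x i * (b * fc i - (K i * B).trace) := by
    intro x
    have := hg2 _ ⟨x, rfl⟩
    rw [hg, ← htr _ (hsymx x)] at this
    refine this.trans_eq ?_
    simp only [pencilEval, Matrix.add_mul, Matrix.trace_add, Finset.sum_mul, Matrix.trace_sum,
      Matrix.smul_mul, Matrix.trace_smul, smul_eq_mul, mul_sub, Finset.sum_sub_distrib,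
      mul_add, Finset.mul_sum]
    have : ∑ i, b * (x i * fc i) = ∑ i, x i * (b * fc i) :=
      Finset.sum_congr rfl fun i _ => by ring
    rw [this]
    ring
  obtain ⟨h1, h2⟩ := aux_affine fun x => hu.trans (hT x)
  refine ⟨B, b, b * f0 - (K0 * B).trace, hBpsd, hb, h1, ?_, by ring, fun i => by linarith [h2 i]⟩
  intro hb0 hB
  have h3 : u ≤ 0 := by simpa [hb0, hB] using hT 0
  have h4 := hg1 ((fun i j => if i = j then 1 else 0), -1) ⟨by norm_num, by
    intro v hv
    simp only
    rw [hqI]; simpa using hIsum v hv⟩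
  rw [hg, hBI] at h4
  have h5 := htr 1 Matrix.isSymm_one
  rw [hB] at h5
  simp [Matrix.one_apply] at h5
  rw [hb0, ← h5] at h4
  linarith

lemma trace_mul_vecMulVec_self {R : Type*} [CommRing R] {α : ℕ} (M : Matrix (Fin α) (Fin α) R)
    (v : Fin α → R) : (M * Matrix.vecMulVec v v).trace = v ⬝ᵥ (M *ᵥ v) := by
  rw [Matrix.mul_vecMulVec, Matrix.trace_vecMulVec, dotProduct_comm]

lemma trace_mul_sum_vecMulVec {R : Type*} [CommRing R] {α m : ℕ} (M : Matrix (Fin α) (Fin α) R)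
    (v : Fin m → Fin α → R) : (M * ∑ k, Matrix.vecMulVec (v k) (v k)).trace =
      ∑ k, v k ⬝ᵥ (M *ᵥ v k) := by
  rw [Finset.mul_sum, Matrix.trace_sum]
  simp only [trace_mul_vecMulVec_self]

lemma exists_proj {n α : ℕ} (A0 : Matrix (Fin α) (Fin α) ℝ)
    (A : Fin n → Matrix (Fin α) (Fin α) ℝ) :
    ∃ P : Matrix (Fin α) (Fin α) ℝ, A0 * P = 0 ∧ (∀ i, A i * P = 0) ∧
      ∀ w : Fin α → ℝ, A0 *ᵥ w = 0 → (∀ i, A i *ᵥ w = 0) → P *ᵥ w = w := by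
  let N : Submodule ℝ (Fin α → ℝ) :=
    LinearMap.ker A0.mulVecLin ⊓ ⨅ i, LinearMap.ker (A i).mulVecLin
  obtain ⟨g, hg⟩ := N.subtype.exists_leftInverse_of_injective N.ker_subtype
  have hN : ∀ w, w ∈ N ↔ A0 *ᵥ w = 0 ∧ ∀ i, A i *ᵥ w = 0 := by
    intro w
    simp [N, Submodule.mem_iInf]
  have hP : ∀ w, LinearMap.toMatrix' (N.subtype ∘ₗ g) *ᵥ w = (g w : Fin α → ℝ) := by
    intro w
    rw [LinearMap.toMatrix'_mulVec]
    rfl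
  refine ⟨LinearMap.toMatrix' (N.subtype ∘ₗ g), ?_, fun i => ?_, fun w h1 h2 => ?_⟩
  · apply Matrix.ext_of_mulVec_single
    intro j
    rw [← Matrix.mulVec_mulVec, hP, ((hN _).1 (g _).2).1, Matrix.zero_mulVec]
  · apply Matrix.ext_of_mulVec_single
    intro j
    rw [← Matrix.mulVec_mulVec, hP, ((hN _).1 (g _).2).2 i, Matrix.zero_mulVec]
  · rw [hP]
    have := LinearMap.congr_fun hg ⟨w, (hN w).2 ⟨h1, h2⟩⟩
    exact congrArg Subtype.val this

lemma pencilEval_isSymm {n α : ℕ} (K0 : Matrix (Fin α) (Fin α) ℝ)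
    (K : Fin n → Matrix (Fin α) (Fin α) ℝ)
    (hK0 : K0.IsSymm) (hK : ∀ i, (K i).IsSymm) (x : Fin n → ℝ) : (pencilEval K0 K x).IsSymm := by
  unfold pencilEval Matrix.IsSymm
  rw [Matrix.transpose_add, Matrix.transpose_sum, hK0.eq]
  simp [fun i => (hK i).eq]

lemma sep1 {n α : ℕ} (A0 : Matrix (Fin α) (Fin α) ℝ) (A : Fin n → Matrix (Fin α) (Fin α) ℝ)
    (hA0 : A0.IsSymm) (hA : ∀ i, (A i).IsSymm) (f0 : ℝ) (fc : Fin n → ℝ)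
    (hd : ∀ x : Fin n → ℝ, (pencilEval A0 A x).PosSemidef → 0 ≤ f0 + ∑ i, x i * fc i) :
    (∃ (S : Matrix (Fin α) (Fin α) ℝ) (c : ℝ), S.PosSemidef ∧ 0 ≤ c ∧
      f0 = c + (A0 * S).trace ∧ ∀ i, fc i = (A i * S).trace) ∨
    (∃ S : Matrix (Fin α) (Fin α) ℝ, S.PosSemidef ∧ (A0 * S).trace = -1 ∧
      ∀ i, (A i * S).trace = 0) ∨
    (∃ (m : ℕ) (w : Fin m → Fin α → ℝ), (∑ k, w k ⬝ᵥ (A0 *ᵥ w k) = 0) ∧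
      (∀ i, ∑ k, w k ⬝ᵥ (A i *ᵥ w k) = 0) ∧
      ∃ k j, (A0 *ᵥ w k) j ≠ 0 ∨ ∃ i, (A i *ᵥ w k) j ≠ 0) := by
  obtain ⟨P, hP0, hP, hPw⟩ := exists_proj A0 A
  have hPx : ∀ x, pencilEval A0 A x * P = 0 := by
    intro x
    simp [pencilEval, Matrix.add_mul, Finset.sum_mul, hP0, hP]
  have hpp : ∀ v : Fin α → ℝ, v ⬝ᵥ ((Pᵀ * P) *ᵥ v) = (P *ᵥ v) ⬝ᵥ (P *ᵥ v) := by
    intro v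
    rw [← Matrix.mulVec_mulVec, Matrix.dotProduct_mulVec, Matrix.vecMul_transpose]
  obtain ⟨B, b, c, hB, hb, hc, hne, e0, ei⟩ := sep0 (A0 + Pᵀ * P) A
    (by rw [Matrix.IsSymm, Matrix.transpose_add, hA0.eq, Matrix.transpose_mul,
          Matrix.transpose_transpose]) hA f0 fc (by
      intro x hx
      apply hd
      have hs := pencilEval_isSymm A0 A hA0 hA x
      have hx' : pencilEval (A0 + Pᵀ * P) A x = pencilEval A0 A x + Pᵀ * P := by
        simp only [pencilEval]
        abel
      rw [hx'] at hx
      refine .of_dotProduct_mulVec_nonneg ?_ fun v => ?_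
      · rw [Matrix.IsHermitian, Matrix.conjTranspose_eq_transpose_of_trivial]
        exact hs
      · have h1 := hx.dotProduct_mulVec_nonneg (v - P *ᵥ v)
        have hAP : pencilEval A0 A x *ᵥ (P *ᵥ v) = 0 := by
          rw [Matrix.mulVec_mulVec, hPx, Matrix.zero_mulVec]
        have hPP : P *ᵥ (P *ᵥ v) = P *ᵥ v := by
          apply hPw
          · rw [Matrix.mulVec_mulVec, hP0, Matrix.zero_mulVec]
          · intro i
            rw [Matrix.mulVec_mulVec, hP, Matrix.zero_mulVec]
        have hPA : (P *ᵥ v) ⬝ᵥ (pencilEval A0 A x *ᵥ v) = 0 := by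
          rw [Matrix.dotProduct_mulVec, ← Matrix.mulVec_transpose, hs.eq, hAP, zero_dotProduct]
        simp only [star_trivial] at h1 ⊢
        rw [Matrix.add_mulVec, dotProduct_add, hpp, Matrix.mulVec_sub P, hPP, sub_self,
          dotProduct_zero, add_zero, Matrix.mulVec_sub, hAP, sub_zero, sub_dotProduct, hPA,
          sub_zero] at h1
        exact h1)
  rw [Matrix.add_mul, Matrix.trace_add] at e0
  obtain ⟨m, w, hw⟩ := Matrix.posSemidef_iff_eq_sum_vecMulVec.mp hB
  simp only [star_trivial] at hw
  have htP : (Pᵀ * P * B).trace = ∑ k, (P *ᵥ w k) ⬝ᵥ (P *ᵥ w k) := by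
    rw [hw, trace_mul_sum_vecMulVec]
    simp only [hpp]
  have htP0 : 0 ≤ (Pᵀ * P * B).trace := by
    rw [htP]
    exact Finset.sum_nonneg fun k _ => Finset.sum_nonneg fun i _ => mul_self_nonneg _
  rcases hb.eq_or_lt with hb0 | hbpos
  · subst hb0
    simp only [zero_mul] at e0 ei
    right
    rcases (show (A0 * B).trace ≤ 0 by linarith).lt_or_eq with hlt | heq
    · left
      refine ⟨(-(A0 * B).trace)⁻¹ • B, hB.smul (by
        rw [inv_nonneg]; linarith), ?_, fun i => ?_⟩
      · rw [Matrix.mul_smul, Matrix.trace_smul, smul_eq_mul, inv_neg, neg_mul,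
          inv_mul_cancel₀ hlt.ne]
      · rw [Matrix.mul_smul, Matrix.trace_smul, ← ei, smul_zero]
    · right
      have hP0' : ∑ k, (P *ᵥ w k) ⬝ᵥ (P *ᵥ w k) = 0 := by linarith
      refine ⟨m, w, ?_, fun i => ?_, ?_⟩
      · rw [← trace_mul_sum_vecMulVec, ← hw, heq]
      · rw [← trace_mul_sum_vecMulVec, ← hw, ← ei]
      · by_contra! hcon
        apply hne rfl
        rw [hw]
        refine Finset.sum_eq_zero fun k _ => ?_
        have h1 : P *ᵥ w k = w k := hPw _ (funext fun j => (hcon k j).1)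
          fun i => funext fun j => (hcon k j).2 i
        have h2 := (Finset.sum_eq_zero_iff_of_nonneg (fun k _ =>
          Finset.sum_nonneg fun i _ => mul_self_nonneg _)).1 hP0' k (Finset.mem_univ _)
        rw [h1] at h2
        rw [dotProduct_self_eq_zero.1 h2]
        simp
  · left
    refine ⟨b⁻¹ • B, b⁻¹ * (c + (Pᵀ * P * B).trace), hB.smul (by positivity), by positivity, ?_,
      fun i => ?_⟩
    · rw [Matrix.mul_smul, Matrix.trace_smul, smul_eq_mul, ← mul_add,
        eq_inv_mul_iff_mul_eq₀ hbpos.ne', e0]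
      ring
    · rw [Matrix.mul_smul, Matrix.trace_smul, smul_eq_mul, eq_inv_mul_iff_mul_eq₀ hbpos.ne', ei]

/-- affine polynomial with given coefficients -/
def affPoly {n : ℕ} (a : ℝ) (c : Fin n → ℝ) : RP n := C a + ∑ i, X i * C (c i)

lemma affPoly_degree {n : ℕ} (a : ℝ) (c : Fin n → ℝ) : (affPoly a c).totalDegree ≤ 1 := by
  unfold affPoly
  refine (totalDegree_add _ _).trans (max_le (by simp) ?_)
  refine totalDegree_finsetSum_le fun i _ => ?_
  refine (totalDegree_mul _ _).trans ?_
  simp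

lemma affPoly_eval {n : ℕ} (a : ℝ) (c : Fin n → ℝ) (x : Fin n → ℝ) :
    eval x (affPoly a c) = a + ∑ i, x i * c i := by
  simp [affPoly]

lemma exists_affPoly {n : ℕ} (f : RP n) (hf : f.totalDegree ≤ 1) : ∃ a c, f = affPoly a c := by
  refine ⟨coeff 0 f, fun i => coeff (Finsupp.single i 1) f, ?_⟩
  ext m
  by_cases hm : m.degree ≤ 1
  · rcases Nat.le_one_iff_eq_zero_or_eq_one.1 hm with h | h
    · rw [Finsupp.degree_eq_zero_iff] at h
      subst h
      simp [affPoly, coeff_sum, mul_comm (X _), coeff_C_mul]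
    · obtain ⟨i, rfl⟩ := (Finsupp.sum_eq_one_iff m).1 h
      have hne : (0 : Fin n →₀ ℕ) ≠ Finsupp.single i 1 := by
        intro h'
        have := DFunLike.congr_fun h' i
        simp at this
      simp [affPoly, coeff_sum, mul_comm (X _), coeff_C_mul, coeff_X, coeff_C,
        Finsupp.single_left_inj, hne]
  · have h0 : ∀ g : RP n, g.totalDegree ≤ 1 → coeff m g = 0 := by
      intro g hg
      apply coeff_eq_zero_of_totalDegree_lt
      rw [Finsupp.degree_apply] at hm
      omega
    rw [h0 f hf, h0 _ (affPoly_degree _ _)]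

lemma affPoly_zero {n : ℕ} : affPoly (n := n) 0 (fun _ => 0) = 0 := by simp [affPoly]

lemma pencilPoly_apply {n α : ℕ} (A0 : Matrix (Fin α) (Fin α) ℝ)
    (A : Fin n → Matrix (Fin α) (Fin α) ℝ) (a b : Fin α) :
    pencilPoly A0 A a b = affPoly (A0 a b) (fun i => A i a b) := by
  simp [pencilPoly, affPoly, Matrix.sum_apply]

lemma pencilPoly_trace {n α : ℕ} (A0 : Matrix (Fin α) (Fin α) ℝ)
    (A : Fin n → Matrix (Fin α) (Fin α) ℝ) (S : Matrix (Fin α) (Fin α) ℝ) :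
    (pencilPoly A0 A * S.map C).trace =
      affPoly (A0 * S).trace (fun i => (A i * S).trace) := by
  have h : ∀ M : Matrix (Fin α) (Fin α) ℝ,
      (M.map (C : ℝ →+* RP n) * S.map (C : ℝ →+* RP n)).trace = C (M * S).trace := by
    intro M
    rw [← Matrix.map_mul]
    exact (AddMonoidHom.map_trace (C : ℝ →+* RP n) (M * S)).symm
  simp only [pencilPoly, affPoly, Matrix.add_mul, Matrix.trace_add, Finset.sum_mul,
    Matrix.trace_sum, Matrix.smul_mul, Matrix.trace_smul, smul_eq_mul, h]

lemma pencilPoly_mulVec {n α : ℕ} (A0 : Matrix (Fin α) (Fin α) ℝ)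
    (A : Fin n → Matrix (Fin α) (Fin α) ℝ) (w : Fin α → ℝ) (j : Fin α) :
    (pencilPoly A0 A *ᵥ (fun a => C (w a))) j =
      affPoly ((A0 *ᵥ w) j) (fun i => (A i *ᵥ w) j) := by
  simp only [mulVec, dotProduct, pencilPoly_apply, affPoly, map_sum, map_mul, Finset.mul_sum,
    add_mul, Finset.sum_add_distrib, Finset.sum_mul, mul_assoc]
  rw [Finset.sum_comm]

lemma pencilPoly_sum_quad {n α m : ℕ} (A0 : Matrix (Fin α) (Fin α) ℝ)
    (A : Fin n → Matrix (Fin α) (Fin α) ℝ) (w : Fin m → Fin α → ℝ)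
    (h0 : ∑ k, w k ⬝ᵥ (A0 *ᵥ w k) = 0) (h : ∀ i, ∑ k, w k ⬝ᵥ (A i *ᵥ w k) = 0) :
    ∑ k, (fun a => (C (w k a) : RP n)) ⬝ᵥ (pencilPoly A0 A *ᵥ (fun a => C (w k a))) = 0 := by
  rw [← trace_mul_sum_vecMulVec]
  have e : ∑ k, Matrix.vecMulVec (fun a => (C (w k a) : RP n)) (fun a => C (w k a)) =
      (∑ k, Matrix.vecMulVec (w k) (w k)).map C := by
    ext1 a b
    simp [Matrix.sum_apply, Matrix.vecMulVec_apply]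
  rw [e, pencilPoly_trace, trace_mul_sum_vecMulVec, h0]
  simp only [trace_mul_sum_vecMulVec, h, affPoly_zero]

lemma pencilPoly_isSymm {n α : ℕ} (A0 : Matrix (Fin α) (Fin α) ℝ)
    (A : Fin n → Matrix (Fin α) (Fin α) ℝ) (hA0 : A0.IsSymm) (hA : ∀ i, (A i).IsSymm) :
    (pencilPoly A0 A).IsSymm := by
  ext1 a b
  simp only [Matrix.transpose_apply, pencilPoly_apply, hA0.apply a b, fun i => (hA i).apply a b]

lemma quad_expand {R : Type*} [CommRing R] {α : ℕ} (M : Matrix (Fin α) (Fin α) R)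
    (hM : M.IsSymm) (p l : R) (v : Fin α → R) (j : Fin α) :
    (p • v + l • Pi.single j 1) ⬝ᵥ (M *ᵥ (p • v + l • Pi.single j 1)) =
      p ^ 2 * (v ⬝ᵥ (M *ᵥ v)) + 2 * p * l * (M *ᵥ v) j + l ^ 2 * M j j := by
  have h : v ⬝ᵥ (M *ᵥ Pi.single j 1) = (M *ᵥ v) j := by
    rw [Matrix.dotProduct_mulVec, ← Matrix.mulVec_transpose, hM.eq]
    simp
  have h2 : (M *ᵥ Pi.single j 1) j = M j j := by simp
  simp only [Matrix.mulVec_add, Matrix.mulVec_smul, add_dotProduct, dotProduct_add,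
    smul_dotProduct, dotProduct_smul, smul_eq_mul, h, single_dotProduct, one_mul, h2]
  ring

lemma exists_ell {n α m : ℕ} (A0 : Matrix (Fin α) (Fin α) ℝ)
    (A : Fin n → Matrix (Fin α) (Fin α) ℝ) (hA0 : A0.IsSymm) (hA : ∀ i, (A i).IsSymm)
    (w : Fin m → Fin α → ℝ)
    (h0 : ∑ k, w k ⬝ᵥ (A0 *ᵥ w k) = 0) (h : ∀ i, ∑ k, w k ⬝ᵥ (A i *ᵥ w k) = 0)
    (k : Fin m) (j : Fin α) :
    ∃ S : Matrix (Fin α) (Fin α) (RP n), IsSosMatrix S ∧ (∀ a b, (S a b).totalDegree ≤ 2) ∧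
      (affPoly ((A0 *ᵥ w k) j) (fun i => (A i *ᵥ w k) j)) ^ 2 +
        (pencilPoly A0 A * S).trace = 0 := by
  set l : RP n := affPoly ((A0 *ᵥ w k) j) (fun i => (A i *ᵥ w k) j) with hl
  set M := pencilPoly A0 A with hM
  let p : RP n := C (-1/2) * (1 + M j j)
  let u : Fin m → Fin α → RP n := fun k' =>
    p • (fun a => C (w k' a)) + (if k' = k then l else 0) • Pi.single j 1
  refine ⟨∑ k', Matrix.vecMulVec (u k') (u k'), ⟨m, u, rfl⟩, fun a b => ?_, ?_⟩
  · have hu : ∀ k' a, (u k' a).totalDegree ≤ 1 := by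
      intro k' a
      simp only [u, Pi.add_apply, Pi.smul_apply, smul_eq_mul]
      have hp : p.totalDegree ≤ 1 := by
        refine (totalDegree_mul _ _).trans ?_
        rw [totalDegree_C, zero_add]
        refine (totalDegree_add _ _).trans (max_le (by simp) ?_)
        rw [hM, pencilPoly_apply]
        exact affPoly_degree _ _
      refine (totalDegree_add _ _).trans (max_le ?_ ?_)
      · refine (totalDegree_mul _ _).trans ?_
        rw [totalDegree_C]
        omega
      · refine (totalDegree_mul _ _).trans ?_
        have h1 : (if k' = k then l else 0).totalDegree ≤ 1 := by
          split_ifs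
          · exact affPoly_degree _ _
          · simp
        have h2 : ((Pi.single j 1 : Fin α → RP n) a).totalDegree = 0 := by
          by_cases hja : a = j
          · subst hja; simp
          · simp [hja]
        omega
    rw [Matrix.sum_apply]
    refine totalDegree_finsetSum_le fun k' _ => ?_
    rw [Matrix.vecMulVec_apply]
    refine (totalDegree_mul _ _).trans ?_
    have := hu k' a
    have := hu k' b
    omega
  · rw [trace_mul_sum_vecMulVec]
    have hsum : ∀ k', u k' ⬝ᵥ (M *ᵥ u k') =
        p ^ 2 * ((fun a => (C (w k' a) : RP n)) ⬝ᵥ (M *ᵥ (fun a => C (w k' a)))) +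
        (if k' = k then 2 * p * l * l + l ^ 2 * M j j else 0) := by
      intro k'
      simp only [u]
      rw [quad_expand M (pencilPoly_isSymm A0 A hA0 hA), add_assoc]
      congr 1
      split_ifs with hk
      · rw [hk, hM, pencilPoly_mulVec, ← hl]
      · simp
    rw [Finset.sum_congr rfl fun k' _ => hsum k', Finset.sum_add_distrib, ← Finset.mul_sum,
      pencilPoly_sum_quad A0 A w h0 h]
    simp only [Finset.sum_ite_eq', Finset.mem_univ, if_true]
    have h2 : (2 : RP n) * C (-1/2) = -1 := by
      have : (2 : RP n) = C 2 := (map_ofNat C 2).symm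
      rw [this, ← C_mul]
      norm_num
    simp only [p]
    linear_combination (l ^ 2 * (1 + M j j)) * h2

/-- The conclusion of the Positivstellensatz. -/
def Cert {n α : ℕ} (A0 : Matrix (Fin α) (Fin α) ℝ)
    (A : Fin n → Matrix (Fin α) (Fin α) ℝ) (f : RP n) : Prop :=
  ∃ (ℓ : Fin n → RP n) (Smat : Fin n → Matrix (Fin α) (Fin α) (RP n))
        (S : Matrix (Fin α) (Fin α) ℝ) (c : ℝ),
        (∀ i, (ℓ i).totalDegree ≤ 1) ∧
        (∀ i, IsSosMatrix (Smat i) ∧ ∀ a b, ((Smat i) a b).totalDegree ≤ 2) ∧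
        S.PosSemidef ∧ 0 ≤ c ∧
        (∀ i : Fin n, ℓ i ^ 2 + (pencilPoly A0 A * Smat i).trace ∈
            Ideal.span (ℓ '' {j : Fin n | j < i})) ∧
        f - C c - (pencilPoly A0 A * S.map C).trace ∈ Ideal.span (Set.range ℓ)

lemma pencilPoly_map_eval {n α : ℕ} (A0 : Matrix (Fin α) (Fin α) ℝ)
    (A : Fin n → Matrix (Fin α) (Fin α) ℝ) (x : Fin n → ℝ) :
    (pencilPoly A0 A).map (eval x) = pencilEval A0 A x := by
  ext1 a b
  rw [Matrix.map_apply, pencilPoly_apply, affPoly_eval]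
  simp [pencilEval, Matrix.sum_apply]

lemma map_trace_mul {R R' : Type*} [CommRing R] [CommRing R'] {α : ℕ} (φ : R →+* R')
    (M N : Matrix (Fin α) (Fin α) R) : φ (M * N).trace = (M.map φ * N.map φ).trace := by
  rw [← Matrix.map_mul]
  exact AddMonoidHom.map_trace φ (M * N)

lemma trace_mul_nonneg {α : ℕ} {M : Matrix (Fin α) (Fin α) ℝ} (hM : M.PosSemidef) {m : ℕ}
    (v : Fin m → Fin α → ℝ) : 0 ≤ (M * ∑ k, Matrix.vecMulVec (v k) (v k)).trace := by
  rw [trace_mul_sum_vecMulVec]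
  exact Finset.sum_nonneg fun k _ => by simpa using hM.dotProduct_mulVec_nonneg (v k)

lemma eval_eq_zero_of_mem_span {n : ℕ} {s : Set (RP n)} {x : Fin n → ℝ}
    (hs : ∀ p ∈ s, eval x p = 0) {q : RP n} (hq : q ∈ Ideal.span s) : eval x q = 0 := by
  have : Ideal.span s ≤ RingHom.ker (eval x) := Ideal.span_le.2 fun p hp => hs p hp
  exact this hq

lemma easy_dir {n α : ℕ} (A0 : Matrix (Fin α) (Fin α) ℝ)
    (A : Fin n → Matrix (Fin α) (Fin α) ℝ) (f : RP n) (h : Cert A0 A f)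
    (x : Fin n → ℝ) (hx : (pencilEval A0 A x).PosSemidef) : 0 ≤ eval x f := by
  obtain ⟨ℓ, Smat, S, c, -, hS, hSp, hc, hl, hf⟩ := h
  have hz : ∀ i, eval x (ℓ i) = 0 := by
    intro i
    induction i using WellFoundedLT.induction with
    | ind i ih =>
      have := eval_eq_zero_of_mem_span (x := x) (by
        rintro _ ⟨j, hj, rfl⟩
        exact ih j hj) (hl i)
      rw [map_add, map_pow, map_trace_mul, pencilPoly_map_eval] at this
      obtain ⟨m, v, hv⟩ := (hS i).1
      have e : (Smat i).map (eval x) = ∑ k, Matrix.vecMulVec (fun a => eval x (v k a))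
          (fun a => eval x (v k a)) := by
        rw [hv]
        ext1 a b
        simp [Matrix.sum_apply, Matrix.vecMulVec_apply]
      rw [e] at this
      have h1 := trace_mul_nonneg hx fun k a => eval x (v k a)
      have h2 := sq_nonneg (eval x (ℓ i))
      exact pow_eq_zero_iff (two_ne_zero) |>.1 (by linarith)
  have := eval_eq_zero_of_mem_span (x := x) (by
        rintro _ ⟨j, rfl⟩
        exact hz j) hf
  obtain ⟨m, w, hw⟩ := Matrix.posSemidef_iff_eq_sum_vecMulVec.mp hSp
  simp only [star_trivial] at hw
  have e : (S.map C).map (eval x) = S := by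
    ext1 a b
    simp
  rw [map_sub, map_sub, map_trace_mul, pencilPoly_map_eval, e, eval_C] at this
  have h1 := trace_mul_nonneg hx w
  rw [← hw] at h1
  linarith

lemma cert_of_trace {n α : ℕ} (A0 : Matrix (Fin α) (Fin α) ℝ)
    (A : Fin n → Matrix (Fin α) (Fin α) ℝ) (f0 : ℝ) (fc : Fin n → ℝ)
    (S : Matrix (Fin α) (Fin α) ℝ) (c : ℝ) (hS : S.PosSemidef) (hc : 0 ≤ c)
    (h0 : f0 = c + (A0 * S).trace) (h : ∀ i, fc i = (A i * S).trace) :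
    Cert A0 A (affPoly f0 fc) := by
  refine ⟨fun _ => 0, fun _ => 0, S, c, by simp, fun _ => ⟨⟨0, Fin.elim0, by simp⟩, by simp⟩, hS, hc,
    by simp, ?_⟩
  rw [pencilPoly_trace]
  convert Ideal.zero_mem _ using 1
  simp only [affPoly, h0, h, C_add]
  ring

lemma cert_of_strong {n α : ℕ} (A0 : Matrix (Fin α) (Fin α) ℝ)
    (A : Fin n → Matrix (Fin α) (Fin α) ℝ) (f0 : ℝ) (fc : Fin n → ℝ)
    (S : Matrix (Fin α) (Fin α) ℝ) (hS : S.PosSemidef)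
    (h0 : (A0 * S).trace = -1) (h : ∀ i, (A i * S).trace = 0) :
    Cert A0 A (affPoly f0 fc) := by
  obtain ⟨m, w, hw⟩ := Matrix.posSemidef_iff_eq_sum_vecMulVec.mp hS
  simp only [star_trivial] at hw
  have ht : (pencilPoly A0 A * S.map C).trace = -1 := by
    rw [pencilPoly_trace, h0]
    simp [affPoly, h]
  refine ⟨X, fun i => (X i ^ 2 : RP n) • S.map C, |f0| • S, f0 + |f0|, by simp, fun i => ⟨⟨m,
    fun k a => X i * C (w k a), ?_⟩, fun a b => ?_⟩, hS.smul (abs_nonneg _),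
    by linarith [neg_abs_le f0], fun i => ?_, ?_⟩
  · rw [hw]
    ext1 a b
    simp only [Matrix.smul_apply, Matrix.map_apply, Matrix.sum_apply, Matrix.vecMulVec_apply,
      map_sum, map_mul, smul_eq_mul, Finset.mul_sum]
    refine Finset.sum_congr rfl fun k _ => by ring
  · change (X i ^ 2 * C (S a b) : RP n).totalDegree ≤ 2
    refine (totalDegree_mul _ _).trans ?_
    rw [totalDegree_C, totalDegree_X_pow]
  · rw [Matrix.mul_smul, Matrix.trace_smul, ht]
    simp
  · have e : (|f0| • S).map (C : ℝ → RP n) = (C |f0| : RP n) • S.map C := by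
      ext1 a b
      simp
    rw [e, Matrix.mul_smul, Matrix.trace_smul, ht]
    have : affPoly f0 fc - C (f0 + |f0|) - (C |f0| : RP n) • (-1 : RP n) =
        ∑ i, X i * C (fc i) := by
      simp only [affPoly, C_add, smul_eq_mul]
      ring
    rw [this]
    exact Ideal.sum_mem _ fun i _ => Ideal.mul_mem_right _ _ (Ideal.subset_span ⟨i, rfl⟩)

section Subst

variable {n : ℕ} (k : Fin (n + 1)) (a : ℝ) (c : Fin (n + 1) → ℝ)

/-- value substituted for the `k`-th variable -/
def subVal : RP n := affPoly (-a / c k) (fun j => - c (k.succAbove j) / c k)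

/-- substitution eliminating the `k`-th variable -/
def subHom : RP (n + 1) →ₐ[ℝ] RP n := aeval (k.insertNth (α := fun _ => RP n) (subVal k a c) X)

lemma subHom_k : subHom k a c (X k) = subVal k a c := by simp [subHom]

lemma subHom_succAbove (j : Fin n) : subHom k a c (X (k.succAbove j)) = X j := by simp [subHom]

lemma subHom_rename (p : RP n) : subHom k a c (rename k.succAbove p) = p := by
  have : (subHom k a c).comp (rename k.succAbove) = AlgHom.id ℝ (RP n) := by
    apply MvPolynomial.algHom_ext
    intro j
    simp [subHom_succAbove]
  exact DFunLike.congr_fun this p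

lemma sub_mem_span (hc : c k ≠ 0) (p : RP (n + 1)) :
    p - rename k.succAbove (subHom k a c p) ∈ Ideal.span {affPoly a c} := by
  have : (Ideal.Quotient.mkₐ ℝ (Ideal.span {affPoly a c})) =
      (Ideal.Quotient.mkₐ ℝ (Ideal.span {affPoly a c})).comp
        ((rename k.succAbove).comp (subHom k a c)) := by
    apply MvPolynomial.algHom_ext
    intro j
    simp only [AlgHom.comp_apply]
    refine Ideal.Quotient.eq.2 ?_
    rcases Fin.eq_self_or_eq_succAbove k j with rfl | ⟨j, rfl⟩
    · rw [subHom_k]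
      have e : X j - rename j.succAbove (subVal j a c) = affPoly a c * C (c j)⁻¹ := by
        have h1 : (C (c j) : RP (n+1)) * C (c j)⁻¹ = 1 := by
          rw [← C_mul, mul_inv_cancel₀ hc, C_1]
        simp only [subVal, affPoly, map_add, map_sum, map_mul, rename_C, rename_X]
        rw [Fin.sum_univ_succAbove _ j]
        simp only [div_eq_mul_inv, C_mul, C_neg, add_mul, Finset.sum_mul, neg_mul, mul_neg,
          Finset.sum_neg_distrib, mul_assoc, h1, mul_one]
        ring
      rw [e]
      exact Ideal.mul_mem_right _ _ (Ideal.subset_span rfl)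
    · rw [subHom_succAbove, rename_X, sub_self]
      exact Ideal.zero_mem _
  exact Ideal.Quotient.eq.1 (DFunLike.congr_fun this p)

lemma subHom_affPoly (a' : ℝ) (c' : Fin (n + 1) → ℝ) :
    subHom k a c (affPoly a' c') = affPoly (a' + (-a / c k) * c' k)
      (fun j => c' (k.succAbove j) + (- c (k.succAbove j) / c k) * c' k) := by
  simp only [affPoly, map_add, map_sum, map_mul]
  rw [Fin.sum_univ_succAbove _ k]
  have hC : ∀ r, subHom k a c (C r) = C r := fun r => by simp [subHom]
  simp only [subHom_k, subHom_succAbove, hC, subVal, affPoly, add_mul, mul_add,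
    Finset.sum_add_distrib, Finset.sum_mul, mul_assoc]
  ring

lemma eval_subHom (y : Fin n → ℝ) (p : RP (n + 1)) : eval y (subHom k a c p) =
    eval (k.insertNth (α := fun _ => ℝ) (eval y (subVal k a c)) y) p := by
  have : ((aeval y : RP n →ₐ[ℝ] ℝ)).comp (subHom k a c) =
      (aeval (k.insertNth (α := fun _ => ℝ) (eval y (subVal k a c)) y) :
        RP (n + 1) →ₐ[ℝ] ℝ) := by
    apply MvPolynomial.algHom_ext
    intro j
    simp only [AlgHom.comp_apply]
    rcases Fin.eq_self_or_eq_succAbove k j with rfl | ⟨j, rfl⟩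
    · simp [subHom_k, MvPolynomial.aeval_eq_eval]
    · simp [subHom_succAbove]
  have h := DFunLike.congr_fun this p
  simpa [MvPolynomial.aeval_eq_eval] using h

end Subst

lemma step {n α : ℕ} (A0 : Matrix (Fin α) (Fin α) ℝ)
    (A : Fin (n + 1) → Matrix (Fin α) (Fin α) ℝ) (hA0 : A0.IsSymm) (hA : ∀ i, (A i).IsSymm)
    (f0 : ℝ) (fc : Fin (n + 1) → ℝ)
    (hd : ∀ x, (pencilEval A0 A x).PosSemidef → 0 ≤ eval x (affPoly f0 fc))
    (ih : ∀ (A0 : Matrix (Fin α) (Fin α) ℝ) (A : Fin n → Matrix (Fin α) (Fin α) ℝ),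
      A0.IsSymm → (∀ i, (A i).IsSymm) → ∀ (f0 : ℝ) (fc : Fin n → ℝ),
      (∀ x, (pencilEval A0 A x).PosSemidef → 0 ≤ eval x (affPoly f0 fc)) →
      Cert A0 A (affPoly f0 fc))
    (k : Fin (n + 1)) (a : ℝ) (c : Fin (n + 1) → ℝ) (hc : c k ≠ 0)
    (S0 : Matrix (Fin α) (Fin α) (RP (n + 1))) (hS0 : IsSosMatrix S0)
    (hS0' : ∀ i j, (S0 i j).totalDegree ≤ 2)
    (hl : affPoly a c ^ 2 + (pencilPoly A0 A * S0).trace = 0) :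
    Cert A0 A (affPoly f0 fc) := by
  set σ := subHom k a c with hσ
  let ι : RP n →ₐ[ℝ] RP (n + 1) := rename k.succAbove
  let A0' := A0 + (-a / c k) • A k
  let A' : Fin n → Matrix (Fin α) (Fin α) ℝ :=
    fun j => A (k.succAbove j) + (- c (k.succAbove j) / c k) • A k
  have hσι : ∀ p, σ (ι p) = p := subHom_rename k a c
  have hM : (pencilPoly A0 A).map σ = pencilPoly A0' A' := by
    ext1 i j
    rw [Matrix.map_apply, pencilPoly_apply, pencilPoly_apply, hσ, subHom_affPoly]
    rfl
  have key := ih A0' A' (by simp [A0', Matrix.IsSymm, hA0.eq, (hA k).eq])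
    (fun j => by simp [A', Matrix.IsSymm, (hA (k.succAbove j)).eq, (hA k).eq])
    (f0 + (-a / c k) * fc k) (fun j => fc (k.succAbove j) + (- c (k.succAbove j) / c k) * fc k)
    (by
      intro y hy
      rw [← subHom_affPoly, eval_subHom]
      apply hd
      convert hy using 1
      rw [← pencilPoly_map_eval, ← pencilPoly_map_eval, ← hM]
      ext1 i j
      simp only [Matrix.map_apply]
      rw [hσ, eval_subHom])
  rw [← subHom_affPoly, ← hσ] at key
  obtain ⟨ℓ, Smat, S, d, h1, h2, h3, h4, h5, h6⟩ := key
  have htr : ∀ T : Matrix (Fin α) (Fin α) (RP (n + 1)),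
      σ (pencilPoly A0 A * T).trace = (pencilPoly A0' A' * T.map σ).trace := by
    intro T
    rw [← hM]
    exact map_trace_mul σ.toRingHom _ _
  have lift : ∀ (s : Set (RP n)) (t : Set (RP (n + 1))) (E : RP (n + 1)),
      σ E ∈ Ideal.span s → affPoly a c ∈ t → (∀ p ∈ s, ι p ∈ t) → E ∈ Ideal.span t := by
    intro s t E hE ht hst
    have e : E = (E - ι (σ E)) + ι (σ E) := by ring
    rw [e]
    refine Ideal.add_mem _ ?_ ?_
    · exact Ideal.span_mono (Set.singleton_subset_iff.2 ht) (sub_mem_span k a c hc E)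
    · have h7 : Ideal.span s ≤ (Ideal.span t).comap ι :=
        Ideal.span_le.2 fun p hp => Ideal.subset_span (hst p hp)
      exact h7 hE
  refine ⟨Fin.cons (affPoly a c) (fun j => ι (ℓ j)), Fin.cons S0 (fun j => (Smat j).map ι), S, d,
    ?_, ?_, h3, h4, ?_, ?_⟩
  · intro i
    refine Fin.cases ?_ (fun i => ?_) i
    · exact affPoly_degree a c
    · exact (totalDegree_rename_le _ _).trans (h1 i)
  · intro i
    refine Fin.cases ?_ (fun i => ?_) i
    · exact ⟨hS0, hS0'⟩
    · obtain ⟨⟨m, v, hv⟩, hdeg⟩ := h2 i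
      refine ⟨⟨m, fun k a => ι (v k a), ?_⟩, fun a b => ?_⟩
      · rw [Fin.cons_succ, hv]
        ext1 a b
        simp [Matrix.sum_apply, Matrix.vecMulVec_apply]
      · exact (totalDegree_rename_le _ _).trans (hdeg a b)
  · intro i
    refine Fin.cases ?_ (fun i => ?_) i
    · rw [Fin.cons_zero, Fin.cons_zero, hl]
      exact Ideal.zero_mem _
    · rw [Fin.cons_succ, Fin.cons_succ]
      refine lift (ℓ '' {j | j < i}) _ _ ?_ ⟨0, Fin.succ_pos i, Fin.cons_zero _ _⟩ ?_
      · rw [map_add, map_pow, htr, hσι]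
        have e : ((Smat i).map ι).map σ = Smat i := by
          ext1 a b
          simp [hσι]
        rw [e]
        exact h5 i
      · rintro _ ⟨j, hj, rfl⟩
        exact ⟨j.succ, Fin.succ_lt_succ_iff.2 hj, Fin.cons_succ _ _ _⟩
  · refine lift (Set.range ℓ) _ _ ?_ ⟨0, Fin.cons_zero _ _⟩ ?_
    · have hC : ∀ r, σ (C r) = C r := fun r => by simp [hσ, subHom]
      rw [map_sub, map_sub, htr, hC]
      have e : (S.map (C : ℝ → RP (n + 1))).map σ = S.map C := by
        ext1 a b
        simp [hC]
      rw [e]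
      exact h6
    · rintro _ ⟨j, rfl⟩
      exact ⟨j.succ, Fin.cons_succ _ _ _⟩

lemma cert_of_const {n α : ℕ} (A0 : Matrix (Fin α) (Fin α) ℝ)
    (A : Fin (n + 1) → Matrix (Fin α) (Fin α) ℝ) (f : RP (n + 1)) (a : ℝ) (ha : a ≠ 0)
    (S0 : Matrix (Fin α) (Fin α) (RP (n + 1))) (hS0 : IsSosMatrix S0)
    (hS0' : ∀ i j, (S0 i j).totalDegree ≤ 2)
    (hl : C a ^ 2 + (pencilPoly A0 A * S0).trace = 0) : Cert A0 A f := by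
  refine ⟨fun _ => C a, fun _ => S0, 0, 0, by simp, fun _ => ⟨hS0, hS0'⟩, Matrix.PosSemidef.zero,
    le_rfl, fun i => by rw [hl]; exact Ideal.zero_mem _, ?_⟩
  have : Ideal.span (Set.range fun _ : Fin (n + 1) => (C a : RP (n + 1))) = ⊤ := by
    apply Ideal.eq_top_of_isUnit_mem _ (x := C a) (Ideal.subset_span (Set.mem_range_self 0))
    exact (IsUnit.mk0 a ha).map C
  rw [this]
  trivial

lemma cert_zero {α : ℕ} (A0 : Matrix (Fin α) (Fin α) ℝ)
    (A : Fin 0 → Matrix (Fin α) (Fin α) ℝ) (hA0 : A0.IsSymm) (f0 : ℝ) (fc : Fin 0 → ℝ)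
    (hd : ∀ x, (pencilEval A0 A x).PosSemidef → 0 ≤ eval x (affPoly f0 fc)) :
    Cert A0 A (affPoly f0 fc) := by
  by_cases hp : A0.PosSemidef
  · refine cert_of_trace A0 A f0 fc 0 f0 Matrix.PosSemidef.zero ?_ (by simp) (fun i => i.elim0)
    have := hd 0 (by simpa [pencilEval] using hp)
    simpa [affPoly_eval] using this
  · have : ∃ v : Fin α → ℝ, v ⬝ᵥ (A0 *ᵥ v) < 0 := by
      by_contra! h
      refine hp (.of_dotProduct_mulVec_nonneg ?_ fun v => by simpa using h v)
      rw [Matrix.IsHermitian, Matrix.conjTranspose_eq_transpose_of_trivial]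
      exact hA0
    obtain ⟨v, hv⟩ := this
    refine cert_of_strong A0 A f0 fc ((-(v ⬝ᵥ (A0 *ᵥ v)))⁻¹ • Matrix.vecMulVec v v) ?_ ?_
      (fun i => i.elim0)
    · refine Matrix.PosSemidef.smul ?_ (by rw [inv_nonneg]; linarith)
      simpa using Matrix.posSemidef_vecMulVec_self_star v
    · rw [Matrix.mul_smul, Matrix.trace_smul, trace_mul_vecMulVec_self, smul_eq_mul, inv_neg,
        neg_mul, inv_mul_cancel₀ hv.ne]

lemma hard_dir {n α : ℕ} (A0 : Matrix (Fin α) (Fin α) ℝ)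
    (A : Fin n → Matrix (Fin α) (Fin α) ℝ) (hA0 : A0.IsSymm) (hA : ∀ i, (A i).IsSymm)
    (f0 : ℝ) (fc : Fin n → ℝ)
    (hd : ∀ x, (pencilEval A0 A x).PosSemidef → 0 ≤ eval x (affPoly f0 fc)) :
    Cert A0 A (affPoly f0 fc) := by
  induction n generalizing A0 f0 with
  | zero => exact cert_zero A0 A hA0 f0 fc hd
  | succ n ih =>
    rcases sep1 A0 A hA0 hA f0 fc (fun x hx => by
      have := hd x hx
      rwa [affPoly_eval] at this) with
      ⟨S, c, hS, hc, h0, h⟩ | ⟨S, hS, h0, h⟩ | ⟨m, w, h0, h, k, j, hne⟩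
    · exact cert_of_trace A0 A f0 fc S c hS hc h0 h
    · exact cert_of_strong A0 A f0 fc S hS h0 h
    · obtain ⟨S, hS, hS', hl⟩ := exists_ell A0 A hA0 hA w h0 h k j
      by_cases hi : ∃ i, (A i *ᵥ w k) j ≠ 0
      · obtain ⟨i, hi⟩ := hi
        exact step A0 A hA0 hA f0 fc hd
          (fun A0 A hA0 hA f0 fc hd => ih A0 A hA0 hA f0 fc hd) i _ _ hi S hS hS' hl
      · have ha := hne.resolve_right hi
        push Not at hi
        refine cert_of_const A0 A _ _ ha S hS hS' ?_
        rw [← hl]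
        simp [affPoly, hi]

/-- Positivstellensatz for linear polynomials on spectrahedra. -/
theorem stmt_7 {n α : ℕ} (A0 : Matrix (Fin α) (Fin α) ℝ)
    (A : Fin n → Matrix (Fin α) (Fin α) ℝ) (hA0 : A0.IsSymm) (hA : ∀ i, (A i).IsSymm)
    (f : RP n) (hf : f.totalDegree ≤ 1) :
    (∀ x : Fin n → ℝ, (pencilEval A0 A x).PosSemidef → 0 ≤ eval x f) ↔
      ∃ (ℓ : Fin n → RP n) (Smat : Fin n → Matrix (Fin α) (Fin α) (RP n))
        (S : Matrix (Fin α) (Fin α) ℝ) (c : ℝ),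
        (∀ i, (ℓ i).totalDegree ≤ 1) ∧
        (∀ i, IsSosMatrix (Smat i) ∧ ∀ a b, ((Smat i) a b).totalDegree ≤ 2) ∧
        S.PosSemidef ∧ 0 ≤ c ∧
        (∀ i : Fin n, ℓ i ^ 2 + (pencilPoly A0 A * Smat i).trace ∈
            Ideal.span (ℓ '' {j : Fin n | j < i})) ∧
        f - C c - (pencilPoly A0 A * S.map C).trace ∈ Ideal.span (Set.range ℓ) := by
  constructor
  · intro h
    obtain ⟨a, c, rfl⟩ := exists_affPoly f hf
    exact hard_dir A0 A hA0 hA a c h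
  · intro h x hx
    exact easy_dir A0 A f h x hx
end
end

section
/- Let A be a linear pencil and f a linear polynomial with f ≥ 0 on S_A. Then for every ε > 0 one has f + ε ∈ M_A, where M_A = {s + Σ_i v_i^* A v_i : s a sum of squares in ℝ[x], v_i ∈ ℝ[x]^α} is the quadratic module associated to A. Conversely, if f + ε ∈ M_A for all ε > 0 then f ≥ 0 on S_A. -/
open MvPolynomial Matrix
attribute [local instance] Matrix.frobeniusNormedAddCommGroup

noncomputable section

theorem isCompact_convexHull_aux {E : Type*} [NormedAddCommGroup E] [NormedSpace ℝ E]
    [FiniteDimensional ℝ E] {T : Set E} (hT : IsCompact T) : IsCompact (convexHull ℝ T) := by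
  have key : convexHull ℝ T = ⋃ k ∈ Finset.range (Module.finrank ℝ E + 2),
      (fun p : (Fin k → ℝ) × (Fin k → E) => ∑ i, p.1 i • p.2 i) ''
        (stdSimplex ℝ (Fin k) ×ˢ Set.univ.pi (fun _ => T)) := by
    apply Set.Subset.antisymm
    · intro x hx
      obtain ⟨ι, _, z, w, hz, hind, hw, hw1, hx⟩ := eq_pos_convex_span_of_mem_convexHull hx
      have hcard : Fintype.card ι < Module.finrank ℝ E + 2 := by
        have h1 := hind.card_le_finrank_succ
        have h2 := Submodule.finrank_le (vectorSpan ℝ (Set.range z))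
        omega
      simp only [Set.mem_iUnion]
      refine ⟨Fintype.card ι, Finset.mem_range.2 hcard,
        (w ∘ (Fintype.equivFin ι).symm, z ∘ (Fintype.equivFin ι).symm), ⟨⟨?_, ?_⟩, ?_⟩, ?_⟩
      · intro i
        exact (hw _).le
      · rw [← hw1]
        exact Equiv.sum_comp (Fintype.equivFin ι).symm w
      · intro i _
        exact hz ⟨_, rfl⟩
      · rw [← hx]
        exact Equiv.sum_comp (Fintype.equivFin ι).symm (fun i => w i • z i)
    · intro x hx
      simp only [Set.mem_iUnion] at hx
      obtain ⟨k, _, ⟨w, z⟩, ⟨⟨hw, hw1⟩, hz⟩, rfl⟩ := hx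
      exact (convex_convexHull ℝ T).sum_mem (fun i _ => hw i) hw1
        (fun i _ => subset_convexHull ℝ T (hz i trivial))
  rw [key]
  refine (Finset.range _).isCompact_biUnion fun k _ => ?_
  refine IsCompact.image ((isCompact_stdSimplex ℝ (Fin k)).prod (isCompact_univ_pi fun _ => hT)) ?_
  fun_prop

section QM

variable {n α : ℕ} (A0 : Matrix (Fin α) (Fin α) ℝ) (A : Fin n → Matrix (Fin α) (Fin α) ℝ)

theorem IsSos.add_aux {p q : RP n} (hp : IsSos p) (hq : IsSos q) : IsSos (p + q) := by
  obtain ⟨k, a, rfl⟩ := hp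
  obtain ⟨l, b, rfl⟩ := hq
  refine ⟨k + l, Fin.append a b, ?_⟩
  rw [Fin.sum_univ_add]
  simp

theorem IsSos.sq_mul_aux {p : RP n} (hp : IsSos p) (q : RP n) : IsSos (q ^ 2 * p) := by
  obtain ⟨k, a, rfl⟩ := hp
  refine ⟨k, fun i => q * a i, ?_⟩
  rw [Finset.mul_sum]
  simp [mul_pow]

theorem IsSos.sq_aux (q : RP n) : IsSos (q ^ 2) := ⟨1, fun _ => q, by simp⟩

theorem IsSos.zero_aux : IsSos (0 : RP n) := ⟨0, fun _ => 0, by simp⟩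

variable {A0 A}

theorem qm_add {p q : RP n} (hp : InQuadModule A0 A p) (hq : InQuadModule A0 A q) :
    InQuadModule A0 A (p + q) := by
  obtain ⟨s, hs, k, v, rfl⟩ := hp
  obtain ⟨t, ht, l, w, rfl⟩ := hq
  refine ⟨s + t, hs.add_aux ht, k + l, Fin.append v w, ?_⟩
  rw [Fin.sum_univ_add]
  simp
  ring

theorem qm_sq_mul {p : RP n} (hp : InQuadModule A0 A p) (q : RP n) :
    InQuadModule A0 A (q ^ 2 * p) := by
  obtain ⟨s, hs, k, v, rfl⟩ := hp
  refine ⟨q ^ 2 * s, hs.sq_mul_aux q, k, fun j => q • v j, ?_⟩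
  rw [mul_add, Finset.mul_sum]
  congr 1
  refine Finset.sum_congr rfl fun j _ => ?_
  simp only [quadForm, Matrix.mulVec_smul, smul_dotProduct, dotProduct_smul, smul_eq_mul]
  ring

theorem qm_sq (q : RP n) : InQuadModule A0 A (q ^ 2) :=
  ⟨q ^ 2, IsSos.sq_aux q, 0, fun _ _ => 0, by simp⟩

theorem qm_quad (v : Fin α → RP n) : InQuadModule A0 A (quadForm (pencilPoly A0 A) v) :=
  ⟨0, IsSos.zero_aux, 1, fun _ => v, by simp⟩

/-- `M_A + J` -/
def QMJ (A0 : Matrix (Fin α) (Fin α) ℝ) (A : Fin n → Matrix (Fin α) (Fin α) ℝ)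
    (J : Ideal (RP n)) (p : RP n) : Prop := ∃ m, InQuadModule A0 A m ∧ p - m ∈ J

variable {J : Ideal (RP n)}

theorem qmj_of {p : RP n} (hp : InQuadModule A0 A p) : QMJ A0 A J p := ⟨p, hp, by simp⟩

theorem qmj_of_mem {p : RP n} (hp : p ∈ J) : QMJ A0 A J p :=
  ⟨0, by simpa using qm_sq (A0 := A0) (A := A) 0, by simpa⟩

theorem qmj_add {p q : RP n} (hp : QMJ A0 A J p) (hq : QMJ A0 A J q) : QMJ A0 A J (p + q) := by
  obtain ⟨m, hm, h1⟩ := hp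
  obtain ⟨m', hm', h2⟩ := hq
  refine ⟨m + m', qm_add hm hm', ?_⟩
  convert J.add_mem h1 h2 using 1
  ring

theorem qmj_sq_mul {p : RP n} (hp : QMJ A0 A J p) (q : RP n) : QMJ A0 A J (q ^ 2 * p) := by
  obtain ⟨m, hm, h1⟩ := hp
  refine ⟨q ^ 2 * m, qm_sq_mul hm q, ?_⟩
  convert J.mul_mem_left (q ^ 2) h1 using 1
  ring

theorem C_sqrt_sq {c : ℝ} (hc : 0 ≤ c) : (C c : RP n) = (C (Real.sqrt c)) ^ 2 := by
  rw [← C_pow, Real.sq_sqrt hc]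

theorem qmj_C_mul {p : RP n} (hp : QMJ A0 A J p) {c : ℝ} (hc : 0 ≤ c) :
    QMJ A0 A J (C c * p) := by
  rw [C_sqrt_sq hc]
  exact qmj_sq_mul hp _

theorem C_mul_C_inv {c : ℝ} (hc : c ≠ 0) : (C c : RP n) * C c⁻¹ = 1 := by
  rw [← C_mul, mul_inv_cancel₀ hc, C_1]

/-- The good ideals. -/
def GoodIdeal (A0 : Matrix (Fin α) (Fin α) ℝ) (A : Fin n → Matrix (Fin α) (Fin α) ℝ)
    (J : Ideal (RP n)) : Prop :=
  ∀ f : RP n, (∀ ε > (0:ℝ), QMJ A0 A J (f + C ε)) → ∀ ε > (0:ℝ), InQuadModule A0 A (f + C ε)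

theorem good_bot : GoodIdeal A0 A ⊥ := by
  intro f hf ε hε
  obtain ⟨m, hm, h⟩ := hf ε hε
  rw [Ideal.mem_bot, sub_eq_zero] at h
  rwa [h]

theorem good_sup (hJ : GoodIdeal A0 A J) {p : RP n} (hp : QMJ A0 A J (-p ^ 2)) :
    GoodIdeal A0 A (J ⊔ Ideal.span {p}) := by
  intro f hf
  apply hJ
  intro ε hε
  obtain ⟨m, hm, h⟩ := hf (ε / 2) (half_pos hε)
  obtain ⟨j, hj, k, hk, hjk⟩ := Submodule.mem_sup.1 h
  obtain ⟨q, rfl⟩ := Ideal.mem_span_singleton'.1 hk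
  have h1 : QMJ A0 A J (C (ε / 2) * (1 + C ε⁻¹ * (q * p)) ^ 2) :=
    qmj_C_mul (qmj_of (qm_sq _)) (by positivity)
  have h2 : QMJ A0 A J (C (ε / 2) * ((C ε⁻¹ * q) ^ 2 * (-p ^ 2))) :=
    qmj_C_mul (qmj_sq_mul hp _) (by positivity)
  have h3 := qmj_add (qmj_add (qmj_of hm) (qmj_of_mem hj)) (qmj_add h1 h2)
  convert h3 using 1
  have e1 : (C ε : RP n) = C (ε / 2) + C (ε / 2) := by rw [← C_add]; congr 1; ring
  have e2 : (C (ε / 2) : RP n) * C ε⁻¹ * 2 = 1 := by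
    rw [← C_mul_C_inv hε.ne', e1]; ring
  have : f = m + j + q * p - C (ε / 2) := by linear_combination (-1 : RP n) * hjk
  rw [this, e1]
  linear_combination (-(q * p)) * e2

theorem exists_good (A0 : Matrix (Fin α) (Fin α) ℝ) (A : Fin n → Matrix (Fin α) (Fin α) ℝ) :
    ∃ J : Ideal (RP n), GoodIdeal A0 A J ∧ ∀ p, QMJ A0 A J (-p ^ 2) → p ∈ J := by
  obtain ⟨J, hJ, hmax⟩ := set_has_maximal_iff_noetherian.2
    (inferInstance : IsNoetherian (RP n) (RP n)) {J | GoodIdeal A0 A J} ⟨⊥, good_bot⟩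
  refine ⟨J, hJ, fun p hp => ?_⟩
  have h1 := hmax _ (good_sup hJ hp)
  by_contra hpJ
  apply h1
  refine lt_of_le_of_ne le_sup_left fun h => hpJ ?_
  rw [h]
  exact (le_sup_right : Ideal.span {p} ≤ _) (Ideal.mem_span_singleton_self p)

theorem mem_of_pm (hJ : ∀ p, QMJ A0 A J (-p ^ 2) → p ∈ J) {g : RP n}
    (h1 : QMJ A0 A J g) (h2 : QMJ A0 A J (-g)) : g ∈ J := by
  apply hJ
  have e : (C (1 / 2) : RP n) * 2 = 1 := by
    have := C_mul_C_inv (n := n) (c := (2 : ℝ)) (by norm_num)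
    rw [show (C (2 : ℝ) : RP n) = 2 from rfl] at this
    rw [mul_comm]; simpa using this
  have h3 := qmj_add (qmj_sq_mul h2 (C (1 / 2) * (g + 1))) (qmj_sq_mul h1 (C (1 / 2) * (g - 1)))
  convert h3 using 1
  linear_combination (g ^ 2 * (C (1 / 2) * 2 + 1)) * e

end QM

section Lin

variable {n α : ℕ}

/-- Linear polynomials from coefficients. -/
def toPoly (n : ℕ) : (ℝ × (Fin n → ℝ)) →ₗ[ℝ] RP n where
  toFun e := C e.1 + ∑ i, C (e.2 i) * X i
  map_add' a b := by
    simp only [Prod.fst_add, Prod.snd_add, Pi.add_apply, C_add, add_mul, Finset.sum_add_distrib]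
    ring
  map_smul' c a := by
    simp only [Prod.smul_fst, Prod.smul_snd, Pi.smul_apply, smul_eq_mul, C_mul, RingHom.id_apply,
      smul_eq_C_mul, mul_add, Finset.mul_sum, mul_assoc]

theorem toPoly_apply (e : ℝ × (Fin n → ℝ)) : toPoly n e = C e.1 + ∑ i, C (e.2 i) * X i := rfl

theorem eval_toPoly (e : ℝ × (Fin n → ℝ)) (x : Fin n → ℝ) :
    eval x (toPoly n e) = e.1 + ∑ i, e.2 i * x i := by
  simp [toPoly_apply]

theorem exists_toPoly (f : RP n) (hf : f.totalDegree ≤ 1) : ∃ e, toPoly n e = f := by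
  have hmem : ∀ d ∈ f.support, ∃ e, toPoly n e = monomial d (coeff d f) := by
    intro d hd
    have h1 : d.degree ≤ 1 := (le_totalDegree hd).trans hf
    rcases Nat.le_one_iff_eq_zero_or_eq_one.1 h1 with h | h
    · rw [Finsupp.degree_eq_zero_iff] at h
      subst h
      exact ⟨(coeff 0 f, 0), by simp [toPoly_apply]⟩
    · obtain ⟨i, rfl⟩ : ∃ i, d = Finsupp.single i 1 := by
        have hd0 : d ≠ 0 := by
          rintro rfl
          simp at h
        obtain ⟨i, hi⟩ := Finsupp.ne_iff.1 hd0
        have hi1 : Finsupp.single i 1 ≤ d := by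
          rw [Finsupp.single_le_iff]
          exact Nat.one_le_iff_ne_zero.2 hi
        obtain ⟨c, hc⟩ := exists_add_of_le hi1
        refine ⟨i, ?_⟩
        rw [hc, map_add, Finsupp.degree_single] at h
        have hc0 : c = 0 := (Finsupp.degree_eq_zero_iff c).1 (by omega)
        rw [hc, hc0, add_zero]
      refine ⟨(0, Pi.single i (coeff (Finsupp.single i 1) f)), ?_⟩
      simp only [toPoly_apply, C_0, zero_add]
      rw [Finset.sum_eq_single i]
      · simp [C_mul_X_eq_monomial]
      · intro j _ hj
        simp [Pi.single_eq_of_ne hj]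
      · simp
  have h2 : f ∈ LinearMap.range (toPoly n) := by
    rw [f.as_sum]
    exact Submodule.sum_mem _ fun d hd => hmem d hd
  exact h2

variable (A0 : Matrix (Fin α) (Fin α) ℝ) (A : Fin n → Matrix (Fin α) (Fin α) ℝ)

/-- coefficients of `w^T A u` -/
def bil (w u : Fin α → ℝ) : ℝ × (Fin n → ℝ) := (w ⬝ᵥ (A0 *ᵥ u), fun i => w ⬝ᵥ (A i *ᵥ u))

theorem bil_add (w u v : Fin α → ℝ) : bil A0 A w (u + v) = bil A0 A w u + bil A0 A w v := by
  ext <;> simp [bil, Matrix.mulVec_add]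

theorem bil_smul (w u : Fin α → ℝ) (c : ℝ) : bil A0 A w (c • u) = c • bil A0 A w u := by
  ext <;> simp [bil, Matrix.mulVec_smul]

theorem smul_bil (w u : Fin α → ℝ) (c : ℝ) : bil A0 A (c • w) u = c • bil A0 A w u := by
  ext <;> simp [bil]

theorem continuous_bil : Continuous fun u => bil A0 A u u := by
  unfold bil
  fun_prop

theorem toPoly_bil (w u : Fin α → ℝ) : toPoly n (bil A0 A w u) =
    (C ∘ w) ⬝ᵥ (pencilPoly A0 A *ᵥ (C ∘ u)) := by
  have hmv : ∀ B : Matrix (Fin α) (Fin α) ℝ,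
      (C ∘ w : Fin α → RP n) ⬝ᵥ (B.map C *ᵥ (C ∘ u)) = C (w ⬝ᵥ (B *ᵥ u)) := by
    intro B
    simp [dotProduct, Matrix.mulVec, map_sum]
  simp only [toPoly_apply, bil, pencilPoly, Matrix.add_mulVec, dotProduct_add, hmv,
    Matrix.sum_mulVec, dotProduct_sum, Matrix.smul_mulVec, dotProduct_smul, smul_eq_mul]
  congr 1
  exact Finset.sum_congr rfl fun i _ => mul_comm _ _

theorem eval_bil (w u : Fin α → ℝ) (x : Fin n → ℝ) :
    eval x (toPoly n (bil A0 A w u)) = w ⬝ᵥ (pencilEval A0 A x *ᵥ u) := by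
  simp only [eval_toPoly, bil, pencilEval, Matrix.add_mulVec, dotProduct_add,
    Matrix.sum_mulVec, dotProduct_sum, Matrix.smul_mulVec, dotProduct_smul, smul_eq_mul]
  congr 1
  exact Finset.sum_congr rfl fun i _ => mul_comm _ _

theorem eval_quadForm (v : Fin α → RP n) (x : Fin n → ℝ) :
    eval x (quadForm (pencilPoly A0 A) v) =
      (fun i => eval x (v i)) ⬝ᵥ (pencilEval A0 A x *ᵥ (fun i => eval x (v i))) := by
  simp [quadForm, dotProduct, Matrix.mulVec, map_sum, pencilPoly, pencilEval, Matrix.sum_apply]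

variable {A0 A}

theorem bil_comm (hA0 : A0.IsSymm) (hA : ∀ i, (A i).IsSymm) (w u : Fin α → ℝ) :
    bil A0 A w u = bil A0 A u w := by
  have key : ∀ B : Matrix (Fin α) (Fin α) ℝ, B.IsSymm → w ⬝ᵥ (B *ᵥ u) = u ⬝ᵥ (B *ᵥ w) := by
    intro B hB
    rw [Matrix.dotProduct_mulVec, ← Matrix.mulVec_transpose, hB.eq, dotProduct_comm]
  ext i
  · exact key _ hA0
  · exact key _ (hA i)

theorem quad_comb (hA0 : A0.IsSymm) (hA : ∀ i, (A i).IsSymm) (w u : Fin α → ℝ) (t h : RP n) :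
    quadForm (pencilPoly A0 A) (t • (C ∘ u) + h • (C ∘ w)) =
      t ^ 2 * toPoly n (bil A0 A u u) + 2 * t * h * toPoly n (bil A0 A w u)
        + h ^ 2 * toPoly n (bil A0 A w w) := by
  have e : toPoly n (bil A0 A u w) = toPoly n (bil A0 A w u) := by rw [bil_comm hA0 hA]
  simp only [toPoly_bil] at e ⊢
  simp only [quadForm, Matrix.mulVec_add, Matrix.mulVec_smul, add_dotProduct, dotProduct_add,
    smul_dotProduct, dotProduct_smul, smul_eq_mul, e]
  ring

theorem kernel_step {J : Ideal (RP n)} (hJ : ∀ p, QMJ A0 A J (-p ^ 2) → p ∈ J)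
    (hA0 : A0.IsSymm) (hA : ∀ i, (A i).IsSymm) (u : Fin α → ℝ)
    (hu : toPoly n (bil A0 A u u) ∈ J) (w : Fin α → ℝ) : toPoly n (bil A0 A w u) ∈ J := by
  apply hJ
  set h := toPoly n (bil A0 A w u) with hh
  set g := toPoly n (bil A0 A w w) with hg
  set t : RP n := C (1 / 2) * (-(1 + g)) with ht
  refine ⟨quadForm (pencilPoly A0 A) (t • (C ∘ u) + h • (C ∘ w)), qm_quad _, ?_⟩
  rw [quad_comb hA0 hA, ← hh, ← hg]
  have e : (C (1 / 2) : RP n) * 2 = 1 := by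
    have := C_mul_C_inv (n := n) (c := (2 : ℝ)) (by norm_num)
    rw [show (C (2 : ℝ) : RP n) = 2 from rfl] at this
    rw [mul_comm]; simpa using this
  have : -h ^ 2 - (t ^ 2 * toPoly n (bil A0 A u u) + 2 * t * h * h + h ^ 2 * g) =
      (-t ^ 2) * toPoly n (bil A0 A u u) := by
    rw [ht]
    linear_combination (h ^ 2 * (1 + g)) * e
  rw [this]
  exact J.mul_mem_left _ hu

theorem main_step {J : Ideal (RP n)} (hJ : ∀ p, QMJ A0 A J (-p ^ 2) → p ∈ J)
    (hA0 : A0.IsSymm) (hA : ∀ i, (A i).IsSymm) (f : RP n) (hf : f.totalDegree ≤ 1)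
    (hpos : ∀ x : Fin n → ℝ, (pencilEval A0 A x).PosSemidef → 0 ≤ eval x f) :
    QMJ A0 A J f := by
  by_cases h1J : (1 : RP n) ∈ J
  · exact qmj_of_mem (by rw [(Ideal.eq_top_iff_one J).2 h1J]; trivial)
  obtain ⟨e, rfl⟩ := exists_toPoly f hf
  let V : Submodule ℝ (ℝ × (Fin n → ℝ)) := (J.restrictScalars ℝ).comap (toPoly n)
  have hV : ∀ e, e ∈ V ↔ toPoly n e ∈ J := fun e => Iff.rfl
  let U : Submodule ℝ (Fin α → ℝ) :=
    { carrier := {u | ∀ w, bil A0 A w u ∈ V}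
      add_mem' := by
        intro a b ha hb w
        rw [bil_add]
        exact V.add_mem (ha w) (hb w)
      zero_mem' := by
        intro w
        have := bil_smul A0 A w 0 0
        rw [zero_smul, zero_smul] at this
        rw [this]
        exact V.zero_mem
      smul_mem' := by
        intro c a ha w
        rw [bil_smul]
        exact V.smul_mem c (ha w) }
  obtain ⟨W, hUW⟩ := Submodule.exists_isCompl U
  have hone : toPoly n ((1 : ℝ), (0 : Fin n → ℝ)) = 1 := by simp [toPoly_apply]
  let T' : Set (ℝ × (Fin n → ℝ)) :=
    insert (1, 0) ((fun u => bil A0 A u u) '' (Metric.sphere 0 1 ∩ (W : Set (Fin α → ℝ))))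
  have hT' : IsCompact T' := by
    refine IsCompact.insert ?_ _
    refine IsCompact.image ?_ (continuous_bil A0 A)
    exact (isCompact_sphere _ _).inter_right W.closed_of_finiteDimensional
  let D : Set (ℝ × (Fin n → ℝ)) := {e | QMJ A0 A J (toPoly n e) ∧ e ∉ V}
  have hDconv : Convex ℝ D := by
    have aux : ∀ p q : ℝ × (Fin n → ℝ), p ∈ D → q ∈ D → ∀ a b : ℝ, 0 < a → 0 ≤ b →
        a • p + b • q ∈ D := by
      intro p q hp hq a b ha hb
      have ha' : QMJ A0 A J (toPoly n (a • p)) := by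
        rw [map_smul, smul_eq_C_mul]; exact qmj_C_mul hp.1 ha.le
      have hb' : QMJ A0 A J (toPoly n (b • q)) := by
        rw [map_smul, smul_eq_C_mul]; exact qmj_C_mul hq.1 hb
      refine ⟨by rw [map_add]; exact qmj_add ha' hb', fun hmem => ?_⟩
      have h3 : QMJ A0 A J (-toPoly n (a • p)) := by
        have := qmj_add hb' (qmj_of_mem (A0 := A0) (A := A) (J.neg_mem hmem))
        convert this using 1
        rw [map_add]; ring
      have h4 : a • p ∈ V := mem_of_pm hJ ha' h3
      exact hp.2 ((V.smul_mem_iff ha.ne').1 h4)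
    intro p hp q hq a b ha hb hab
    rcases ha.eq_or_lt with h | h
    · subst h
      have := aux q p hq hp b 0 (by linarith) le_rfl
      rwa [add_comm] at this
    · exact aux p q hp hq a b h hb
  have hT'D : T' ⊆ D := by
    rintro _ (rfl | ⟨u, ⟨hu1, huW⟩, rfl⟩)
    · refine ⟨by rw [hone]; simpa using qmj_of (J := J) (qm_sq (A0 := A0) (A := A) 1), ?_⟩
      rw [hV, hone]
      exact h1J
    · refine ⟨?_, fun hmem => ?_⟩
      · rw [toPoly_bil]
        exact qmj_of (qm_quad _)
      · have huU : u ∈ U := fun w => kernel_step hJ hA0 hA u hmem w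
        have : u = 0 := Submodule.disjoint_def.1 hUW.disjoint u huU huW
        subst this
        simp at hu1
  have hhull : convexHull ℝ T' ⊆ D := convexHull_min hT'D hDconv
  by_cases hdisj : Disjoint (convexHull ℝ (insert (-e) T')) (V : Set (ℝ × (Fin n → ℝ)))
  · exfalso
    obtain ⟨L, s, t, hL1, hst, hL2⟩ := geometric_hahn_banach_compact_closed
      (convex_convexHull ℝ _) (isCompact_convexHull_aux (hT'.insert (-e))) V.convex
      V.closed_of_finiteDimensional hdisj
    have ht0 : t < 0 := by simpa using hL2 0 V.zero_mem
    have hLV : ∀ v ∈ V, L v = 0 := by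
      intro v hv
      by_contra hne
      have := hL2 ((t / L v) • v) (V.smul_mem _ hv)
      rw [map_smul, smul_eq_mul, div_mul_cancel₀ _ hne] at this
      exact lt_irrefl _ this
    have hLT : ∀ a ∈ insert (-e) T', L a < 0 := fun a ha =>
      ((hL1 a (subset_convexHull ℝ _ ha)).trans hst).trans ht0
    have hl : L (1, 0) < 0 := hLT _ (Or.inr (Or.inl rfl))
    set l := L (1, 0) with hldef
    let x : Fin n → ℝ := fun i => L (0, Pi.single i 1) / l
    have hLx : ∀ a, L a = l * eval x (toPoly n a) := by
      intro a
      have ha : a = a.1 • ((1 : ℝ), (0 : Fin n → ℝ)) +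
          ∑ i, a.2 i • ((0 : ℝ), (Pi.single i 1 : Fin n → ℝ)) := by
        ext j
        · simp [Prod.fst_sum]
        · simp [Prod.snd_sum, Finset.sum_apply, Pi.single_apply]
      conv_lhs => rw [ha]
      rw [map_add, map_sum, eval_toPoly, mul_add, Finset.mul_sum]
      simp only [map_smul, smul_eq_mul]
      congr 1
      · rw [mul_comm]
      · refine Finset.sum_congr rfl fun i _ => ?_
        simp only [x]
        field_simp [hl.ne]
    have hpsd : (pencilEval A0 A x).PosSemidef := by
      refine Matrix.PosSemidef.of_dotProduct_mulVec_nonneg ?_ fun y => ?_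
      · rw [Matrix.IsHermitian, Matrix.conjTranspose_eq_transpose_of_trivial]
        simp only [pencilEval, Matrix.transpose_add, Matrix.transpose_sum, Matrix.transpose_smul,
          hA0.eq, (hA _).eq]
      · have hy : y ∈ U ⊔ W := by rw [hUW.sup_eq_top]; trivial
        obtain ⟨u, hu, w, hw, rfl⟩ := Submodule.mem_sup.1 hy
        have hz : ∀ z, eval x (toPoly n (bil A0 A z u)) = 0 := by
          intro z
          have := hLx (bil A0 A z u)
          rw [hLV _ (hu z)] at this
          exact (mul_eq_zero.1 this.symm).resolve_left hl.ne
        rw [star_trivial, ← eval_bil, bil_add, map_add, map_add, hz, zero_add,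
          bil_comm hA0 hA, bil_add, map_add, map_add, hz, zero_add]
        by_cases hw0 : w = 0
        · subst hw0
          rw [eval_bil]; simp
        have hn : 0 < ‖w‖ := norm_pos_iff.2 hw0
        have hmem : bil A0 A (‖w‖⁻¹ • w) (‖w‖⁻¹ • w) ∈ T' := by
          refine Or.inr ⟨‖w‖⁻¹ • w, ⟨?_, W.smul_mem _ hw⟩, rfl⟩
          rw [mem_sphere_zero_iff_norm, norm_smul, norm_inv, norm_norm, inv_mul_cancel₀ hn.ne']
        have h5 := hLT _ (Or.inr hmem)
        rw [bil_smul, smul_bil, map_smul, map_smul, hLx, smul_eq_mul, smul_eq_mul] at h5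
        by_contra hneg
        push Not at hneg
        have h6 : 0 < l * eval x (toPoly n (bil A0 A w w)) := mul_pos_of_neg_of_neg hl hneg
        have : 0 < ‖w‖⁻¹ * (‖w‖⁻¹ * (l * eval x (toPoly n (bil A0 A w w)))) := by positivity
        linarith
    have h7 := hLT (-e) (Or.inl rfl)
    rw [map_neg, hLx] at h7
    have h8 := hpos x hpsd
    nlinarith
  · obtain ⟨z, hz1, hz2⟩ := Set.not_disjoint_iff.1 hdisj
    have hne : T'.Nonempty := Set.insert_nonempty _ _
    rw [convexHull_insert hne, convexJoin_singleton_left, Set.mem_iUnion₂] at hz1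
    obtain ⟨b, hb, a, c, ha, hc, hac, rfl⟩ := hz1
    have hbD := hhull hb
    rcases ha.eq_or_lt with h | h
    · subst h
      rw [zero_add] at hac
      subst hac
      simp only [zero_smul, one_smul, zero_add] at hz2
      exact absurd hz2 hbD.2
    · have hmem : toPoly n (a • -e + c • b) ∈ J := hz2
      have h9 := qmj_C_mul (qmj_add (qmj_C_mul hbD.1 hc) (qmj_of_mem (A0 := A0) (A := A)
        (J.neg_mem hmem))) (inv_nonneg.2 ha)
      convert h9 using 1
      rw [map_add, map_smul, map_smul, map_neg, smul_eq_C_mul, smul_eq_C_mul]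
      linear_combination (-(toPoly n e)) * C_mul_C_inv (n := n) h.ne'

end Lin

/-- A linear polynomial is nonnegative on `S_A` iff `f + ε ∈ M_A` for every `ε > 0`. -/
theorem stmt_13 {n α : ℕ} (A0 : Matrix (Fin α) (Fin α) ℝ)
    (A : Fin n → Matrix (Fin α) (Fin α) ℝ) (hA0 : A0.IsSymm) (hA : ∀ i, (A i).IsSymm)
    (f : RP n) (hf : f.totalDegree ≤ 1) :
    (∀ x : Fin n → ℝ, (pencilEval A0 A x).PosSemidef → 0 ≤ eval x f) ↔
      ∀ ε > (0:ℝ), InQuadModule A0 A (f + C ε) := by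
  constructor
  · intro hpos
    obtain ⟨J, hJ1, hJ2⟩ := exists_good A0 A
    refine hJ1 f fun ε hε => ?_
    refine qmj_add (main_step hJ2 hA0 hA f hf hpos) (qmj_of ?_)
    rw [C_sqrt_sq hε.le]
    exact qm_sq _
  · intro h x hx
    refine le_of_forall_pos_le_add fun ε hε => ?_
    obtain ⟨s, ⟨k, q, rfl⟩, l, v, hfv⟩ := h ε hε
    have h2 := congrArg (eval x) hfv
    rw [map_add, eval_C, map_add, map_sum, map_sum] at h2
    rw [h2]
    refine add_nonneg (Finset.sum_nonneg fun i _ => ?_) (Finset.sum_nonneg fun j _ => ?_)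
    · rw [map_pow]
      positivity
    · rw [eval_quadForm]
      simpa using hx.dotProduct_mulVec_nonneg (fun i => eval x (v j i))
end
end
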